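/- arXiv:0712.3802 — 2 statements merged into one kernel-verified Lean document; each statement's English description precedes it below -/
import Mathlib

section
/- Let k > 0 and c > 0 be real numbers. Let f⁻ be a nonzero real number with 2k/c + 1/f⁻ ≠ 0, and set f⁺ = (2k/c + 1/f⁻)⁻¹. Then −c/k < f⁻ < −c/(2k) if and only if f⁺ > c/k. -/
/-- A positive number lies below an inverse exactly when the inverted number lies strictly
between zero and the inverse of the positive number. -/
theorem lt_inv_iff_pos_and_lt_inv {a x : ℝ} (ha : 0 < a) : a < x⁻¹ ↔ 0 < x ∧ x < a⁻¹ := by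
  constructor
  · intro h
    have hx : 0 < x := inv_pos.mp (ha.trans h)
    exact ⟨hx, (lt_inv_comm₀ ha hx).mp h⟩
  · rintro ⟨hx, h⟩
    exact (lt_inv_comm₀ ha hx).mpr h

/-- Second equivalence of Proposition 3.5 (focusing case): with
`f⁺ = (2k/c + 1/f⁻)⁻¹`, one has `−c/k < f⁻ < −c/(2k) ↔ f⁺ > c/k`. -/
theorem focusing_second_equiv (k c : ℝ) (hk : 0 < k) (hc : 0 < c)
    (fminus : ℝ) (hfm : fminus ≠ 0) (hden : 2 * k / c + 1 / fminus ≠ 0)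
    (fplus : ℝ) (hfp : fplus = (2 * k / c + 1 / fminus)⁻¹) :
    (-c / k < fminus ∧ fminus < -c / (2 * k)) ↔ c / k < fplus := by
  rw [hfp, lt_inv_iff_pos_and_lt_inv (div_pos hc hk), inv_div]
  rcases hfm.lt_or_gt with hneg | hpos
  · have h₁ : 2 * k / c + 1 / fminus = (2 * k * fminus + c) / (c * fminus) := by
      field_simp
    have h₂ : k / c - (2 * k / c + 1 / fminus) = (-(k * fminus) - c) / (c * fminus) := by
      field_simp
      ring
    have hcf : c * fminus < 0 := mul_neg_of_pos_of_neg hc hneg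
    rw [← sub_pos (b := 2 * k / c + 1 / fminus), h₂, h₁, lt_div_iff_of_neg hcf,
      lt_div_iff_of_neg hcf, div_lt_iff₀ hk, lt_div_iff₀ (by positivity)]
    constructor <;> rintro ⟨h, h'⟩ <;> constructor <;> linarith
  · have h₁ : -c / (2 * k) < 0 := div_neg_of_neg_of_pos (neg_lt_zero.mpr hc) (by positivity)
    have h₂ : 0 < k / c := div_pos hk hc
    have h₃ : 0 < 1 / fminus := one_div_pos.mpr hpos
    have h₄ : 2 * k / c = 2 * (k / c) := mul_div_assoc 2 k c
    constructor <;> rintro ⟨h, h'⟩ <;> exfalso <;> linarith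
end

section
/- Fix real numbers c₁, c₂ with 1 < c₁ ≤ c₂. Then there exist constants A, B, ε > 0 with A ≤ B such that for every x ∈ (0, ε) and every c ∈ [c₁, c₂] one has A·x ≤ tan(arcsin(c·x/2) − arcsin(x/2)) ≤ B·x. -/
open Real

theorem tan_arcsin_sub_arcsin_bounds {a b : ℝ} (ha : 0 ≤ a) (hab : a ≤ b) (hb : b ≤ 1 / 2) :
    (b - a) / 2 ≤ Real.tan (Real.arcsin b - Real.arcsin a) ∧
      Real.tan (Real.arcsin b - Real.arcsin a) ≤ 4 * b := by
  have hp : 1 / 2 ≤ √(1 - b ^ 2) := Real.le_sqrt_of_sq_le (by nlinarith)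
  have hpq : √(1 - b ^ 2) ≤ √(1 - a ^ 2) := Real.sqrt_le_sqrt (by nlinarith)
  have hq : √(1 - a ^ 2) ≤ 1 := Real.sqrt_le_one.mpr (by nlinarith)
  have hcos := Real.cos_le_one (Real.arcsin b - Real.arcsin a)
  rw [Real.cos_sub, Real.sin_arcsin (by linarith) (by linarith),
    Real.sin_arcsin (by linarith) (by linarith), Real.cos_arcsin, Real.cos_arcsin] at hcos
  rw [Real.tan_eq_sin_div_cos, Real.sin_sub, Real.cos_sub,
    Real.sin_arcsin (by linarith) (by linarith), Real.sin_arcsin (by linarith) (by linarith),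
    Real.cos_arcsin, Real.cos_arcsin]
  set p := √(1 - b ^ 2)
  set q := √(1 - a ^ 2)
  have hden : 1 / 4 ≤ p * q + b * a := by
    nlinarith [mul_nonneg (ha.trans hab) ha]
  have hnum : (b - a) / 2 ≤ b * q - p * a := by
    nlinarith [mul_nonneg (sub_nonneg.mpr hab) (sub_nonneg.mpr (hp.trans hpq)),
      mul_nonneg (sub_nonneg.mpr hpq) ha]
  constructor
  · rw [le_div_iff₀ (by linarith)]
    nlinarith
  · rw [div_le_iff₀ (by linarith)]
    nlinarith [mul_nonneg (ha.trans hab) (sub_nonneg.mpr hden),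
      mul_nonneg (ha.trans hab) (sub_nonneg.mpr hq), mul_nonneg (by linarith : 0 ≤ p) ha]

/-- Uniform version of the asymptotic in Proposition 5.1: a two-sided bound
`A·x ≤ tan(arcsin(c·x/2) − arcsin(x/2)) ≤ B·x`, uniform in `c ∈ [c₁, c₂]`. -/
theorem optimal_height_uniform_bound (c₁ c₂ : ℝ) (h₁ : 1 < c₁) (h₂ : c₁ ≤ c₂) :
    ∃ A B ε : ℝ, 0 < A ∧ 0 < B ∧ 0 < ε ∧ A ≤ B ∧
      ∀ x ∈ Set.Ioo (0 : ℝ) ε, ∀ c ∈ Set.Icc c₁ c₂,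
        A * x ≤ Real.tan (Real.arcsin (c * x / 2) - Real.arcsin (x / 2)) ∧
        Real.tan (Real.arcsin (c * x / 2) - Real.arcsin (x / 2)) ≤ B * x := by
  have hc₂ : 0 < c₂ := by linarith
  refine ⟨(c₁ - 1) / 4, 2 * c₂, 1 / c₂, by linarith, by linarith, by positivity, by linarith, ?_⟩
  rintro x ⟨hx, hxε⟩ c ⟨hc₁, hc⟩
  rw [lt_div_iff₀ hc₂] at hxε
  have hcx := mul_le_mul_of_nonneg_right hc hx.le
  have hcx₁ := mul_le_mul_of_nonneg_right hc₁ hx.le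
  obtain ⟨hlower, hupper⟩ := tan_arcsin_sub_arcsin_bounds
    (a := x / 2) (b := c * x / 2) (by linarith) (by nlinarith) (by linarith)
  exact ⟨by linarith, by linarith⟩
end
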